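/- Suppose n = 2^d for some d ≥ 1. Then the quotient of R by the two-sided ideal generated by { y_i² : i ∈ ℤ/nℤ } together with { (y_s y_{s−1})^n : s ∈ ℤ/nℤ } is a finite-dimensional k-vector space. (This is the content of Lemma 5.3(7): the quotient ring R″ obtained by imposing these relations is finite-dimensional.) -/

import Mathlib

open scoped BigOperators

noncomputable section

/-- The relations of the `(-1)`-skew polynomial ring: `x_i x_j = - x_j x_i` for `i ≠ j`. -/
inductive SkewRel (k : Type) [Field k] (n : ℕ) :
    FreeAlgebra k (Fin n) → FreeAlgebra k (Fin n) → Prop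
  | rel (i j : Fin n) (h : i ≠ j) :
      SkewRel k n (FreeAlgebra.ι k i * FreeAlgebra.ι k j)
        (-(FreeAlgebra.ι k j * FreeAlgebra.ι k i))

/-- The `(-1)`-skew polynomial ring `R = k_{-1}[x_1, …, x_n]`. -/
abbrev SkewPoly (k : Type) [Field k] (n : ℕ) := RingQuot (SkewRel k n)

/-- The generator `x_{i+1}` of `R = k_{-1}[x_1, …, x_n]` (indexed by `i : Fin n`). -/
def skewX (k : Type) [Field k] (n : ℕ) (i : Fin n) : SkewPoly k n :=
  RingQuot.mkAlgHom k (SkewRel k n) (FreeAlgebra.ι k i)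

/-- The element `y_j = Σ_{i=1}^n ξ^{i j} x_i`, for `j : ZMod n`. -/
def skewY (k : Type) [Field k] (n : ℕ) (ξ : k) (j : ZMod n) : SkewPoly k n :=
  ∑ i : Fin n, (ξ ^ ((i.val + 1) * j.val)) • skewX k n i

/-- For `i : ZMod n`, the left ideal `L_i` of `R` generated by all the products
`y_{j_1} ⋯ y_{j_m}` with `m ≥ 1` and `j_1 + ⋯ + j_m = i` in `ZMod n`. -/
def skewL (k : Type) [Field k] (n : ℕ) (ξ : k) (i : ZMod n) : Ideal (SkewPoly k n) :=
  Ideal.span {r : SkewPoly k n |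
    ∃ l : List (ZMod n), l ≠ [] ∧ l.sum = i ∧ r = (l.map (skewY k n ξ)).prod}

end

theorem Submodule.span_singleton_mul_list_prod_le {k A ι : Type*} [Field k] [Ring A] [Algebra k A]
    (x : ι → A) (P : ι → Submodule k A)
    (hself : ∀ i, Submodule.span k {x i} * P i ≤ P i)
    (hcomm : ∀ i j, i ≠ j → Submodule.span k {x i} * P j ≤ P j * Submodule.span k {x i})
    (l : List ι) (i : ι) (hi : i ∈ l) :
    Submodule.span k {x i} * (l.map P).prod ≤ (l.map P).prod := by
  induction l with
  | nil => simp at hi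
  | cons j l ih =>
    rw [List.map_cons, List.prod_cons, ← mul_assoc]
    by_cases hij : i = j
    · subst hij
      exact mul_le_mul_left (hself i) _
    · have hil : i ∈ l := by simpa [hij] using hi
      refine (mul_le_mul_left (hcomm i j hij) _).trans ?_
      rw [mul_assoc]
      exact mul_le_mul_right (ih hil) _

theorem Submodule.eq_top_of_one_mem_of_mul_mem {k A : Type*} [Field k] [Ring A] [Algebra k A]
    {s : Set A} (hs : Algebra.adjoin k s = ⊤) (M : Submodule k A) (hone : 1 ∈ M)
    (hmul : ∀ a ∈ s, ∀ m ∈ M, a * m ∈ M) : M = ⊤ := by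
  have key : ∀ a : A, ∀ m ∈ M, a * m ∈ M := by
    intro a
    have ha : a ∈ Algebra.adjoin k s := by rw [hs]; trivial
    induction ha using Algebra.adjoin_induction with
    | mem a ha => exact hmul a ha
    | algebraMap r =>
      intro m hm
      rw [← Algebra.smul_def]
      exact M.smul_mem r hm
    | add a b _ _ iha ihb =>
      intro m hm
      rw [add_mul]
      exact M.add_mem (iha m hm) (ihb m hm)
    | mul a b _ _ iha ihb =>
      intro m hm
      rw [mul_assoc]
      exact iha _ (ihb m hm)
  exact Submodule.eq_top_iff'.2 fun a => by simpa using key a 1 hone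

theorem Module.finite_of_anticommuting_nilpotent_generators {k A ι : Type*} [Field k] [Ring A]
    [Algebra k A] [Fintype ι] (x : ι → A) (hgen : Algebra.adjoin k (Set.range x) = ⊤)
    (hanti : ∀ i j, i ≠ j → x i * x j = -(x j * x i)) (hnil : ∀ i, IsNilpotent (x i)) :
    Module.Finite k A := by
  choose N hN using hnil
  let P : ι → Submodule k A := fun i =>
    Submodule.span k (Set.range fun a : Fin (N i + 1) => x i ^ (a : ℕ))
  have hP : ∀ i (a : ℕ), x i ^ a ∈ P i := by
    intro i a
    by_cases ha : a < N i + 1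
    · exact Submodule.subset_span ⟨⟨a, ha⟩, rfl⟩
    · rw [pow_eq_zero_of_le (by omega) (hN i)]
      exact zero_mem _
  have hself : ∀ i, Submodule.span k {x i} * P i ≤ P i := by
    intro i
    rw [Submodule.span_mul_span, Submodule.span_le]
    rintro _ ⟨_, rfl, _, ⟨a, rfl⟩, rfl⟩
    simpa [pow_succ'] using hP i (a + 1)
  have hpow : ∀ i j, i ≠ j → ∀ a : ℕ, x i * x j ^ a = (-1 : k) ^ a • (x j ^ a * x i) := by
    intro i j hij a
    induction a with
    | zero => simp
    | succ a ih =>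
      rw [pow_succ, ← mul_assoc, ih, smul_mul_assoc, mul_assoc, hanti i j hij, pow_succ]
      simp [mul_assoc]
  have hcomm : ∀ i j, i ≠ j →
      Submodule.span k {x i} * P j ≤ P j * Submodule.span k {x i} := by
    intro i j hij
    rw [Submodule.span_mul_span, Submodule.span_le]
    rintro _ ⟨_, rfl, _, ⟨a, rfl⟩, rfl⟩
    simp only [SetLike.mem_coe, hpow i j hij]
    exact Submodule.smul_mem _ _
      (Submodule.mul_mem_mul (hP j a) (Submodule.mem_span_singleton_self _))
  let l : List ι := Finset.univ.toList
  have hfg : ∀ l : List ι, (l.map P).prod.FG ∧ 1 ∈ (l.map P).prod := by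
    intro l
    induction l with
    | nil => exact ⟨⟨{1}, by simp [Submodule.one_eq_span]⟩, Submodule.one_le.1 le_rfl⟩
    | cons i l ih =>
      rw [List.map_cons, List.prod_cons]
      refine ⟨(Submodule.fg_span (Set.finite_range _)).mul ih.1, ?_⟩
      simpa using Submodule.mul_mem_mul (by simpa using hP i 0) ih.2
  have htop : (l.map P).prod = ⊤ := by
    refine Submodule.eq_top_of_one_mem_of_mul_mem hgen _ (hfg l).2 ?_
    rintro _ ⟨i, rfl⟩ m hm
    exact Submodule.span_singleton_mul_list_prod_le x P hself hcomm l i (by simp [l])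
      (Submodule.mul_mem_mul (Submodule.mem_span_singleton_self _) hm)
  exact ⟨htop ▸ (hfg l).1⟩

theorem Module.finite_quotient_span_of_finite_ringCon_quotient {k R : Type*} [Field k] [Ring R]
    [Algebra k R] (S : Set R) [Module.Finite k (TwoSidedIdeal.span S).ringCon.Quotient] :
    Module.Finite k (R ⧸ Submodule.span k {r : R | ∃ a b g : R, g ∈ S ∧ r = a * g * b}) := by
  let f : R →ₗ[k] (TwoSidedIdeal.span S).ringCon.Quotient :=
    ((TwoSidedIdeal.span S).ringCon.mkₐ (α := k)).toLinearMap
  have hf : Function.Surjective f := RingCon.mkₐ_surjective (α := k) _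
  have hker : LinearMap.ker f ≤
      Submodule.span k {r : R | ∃ a b g : R, g ∈ S ∧ r = a * g * b} := by
    intro r hr
    have hr' : r ∈ TwoSidedIdeal.span S := by
      rw [TwoSidedIdeal.mem_iff]
      exact (RingCon.eq _).1 (show ((r : R) : (TwoSidedIdeal.span S).ringCon.Quotient) =
        ((0 : R) : _) from hr)
    rw [TwoSidedIdeal.mem_span_iff_mem_addSubgroup_closure] at hr'
    refine (AddSubgroup.closure_le (K := (Submodule.span k
      {r : R | ∃ a b g : R, g ∈ S ∧ r = a * g * b}).toAddSubgroup)).2 ?_ hr'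
    rintro _ ⟨_, ⟨a, _, g, hg, rfl⟩, b, _, rfl⟩
    exact Submodule.subset_span ⟨a, b, g, hg, rfl⟩
  have : Module.Finite k (R ⧸ LinearMap.ker f) :=
    Module.Finite.equiv (f.quotKerEquivOfSurjective hf).symm
  exact Module.Finite.of_surjective (Submodule.factor hker) (Submodule.factor_surjective hker)

theorem isNilpotent_mul_add_mul_of_sq_eq_zero {A : Type*} [Ring A] {a b : A} (ha : a ^ 2 = 0)
    (hb : b ^ 2 = 0) (hab : IsNilpotent (a * b)) : IsNilpotent (a * b + b * a) := by
  have huv : a * b * (b * a) = 0 := by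
    rw [mul_assoc, ← mul_assoc b, ← sq, hb, zero_mul, mul_zero]
  have hvu : b * a * (a * b) = 0 := by
    rw [mul_assoc, ← mul_assoc a, ← sq, ha, zero_mul, mul_zero]
  have hba : IsNilpotent (b * a) := by
    obtain ⟨n, hn⟩ := hab
    refine ⟨n + 1, ?_⟩
    have : ∀ m : ℕ, (b * a) ^ (m + 1) = b * (a * b) ^ m * a := by
      intro m
      induction m with
      | zero => simp
      | succ m ih => rw [pow_succ, ih, pow_succ]; simp only [mul_assoc]
    rw [this, hn, mul_zero, zero_mul]
  exact Commute.isNilpotent_add (huv.trans hvu.symm) hab hba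

theorem sum_smul_mul_add_sum_smul_mul {k A ι : Type*} [Field k] [Ring A] [Algebra k A] [Fintype ι]
    (x : ι → A) (hanti : ∀ i j, i ≠ j → x i * x j = -(x j * x i)) (a b : ι → k) :
    (∑ i, a i • x i) * (∑ i, b i • x i) + (∑ i, b i • x i) * (∑ i, a i • x i) =
      (2 : k) • ∑ i, (a i * b i) • x i ^ 2 := by
  classical
  rw [Finset.sum_mul_sum, Finset.sum_mul_sum, Finset.sum_comm (γ := ι)
    (f := fun i j => b i • x i * a j • x j), ← Finset.sum_add_distrib, Finset.smul_sum]
  refine Finset.sum_congr rfl fun i _ => ?_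
  rw [← Finset.sum_add_distrib, Finset.sum_eq_single i]
  · simp only [smul_mul_smul_comm, mul_comm (b i), ← sq, two_smul]
  · intro j _ hj
    rw [smul_mul_smul_comm, smul_mul_smul_comm, hanti i j hj.symm, mul_comm (b j)]
    simp
  · simp

theorem ZMod.sum_pow_val_eq_ite {k : Type*} [Field k] [DecidableEq k] (n : ℕ) [NeZero n] (ζ : k)
    (hζ : ζ ^ n = 1) : ∑ m : ZMod n, ζ ^ m.val = if ζ = 1 then (n : k) else 0 := by
  split_ifs with h
  · simp [h]
  · have hsum : ∑ m : ZMod n, ζ ^ m.val = ∑ m ∈ Finset.range n, ζ ^ m := by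
      obtain ⟨n, rfl⟩ := Nat.exists_eq_succ_of_ne_zero (NeZero.ne n)
      exact Fin.sum_univ_eq_sum_range (fun m => ζ ^ m) _
    rw [hsum, geom_sum_eq h, hζ, sub_self, zero_div]

theorem isNilpotent_of_fourier_sums {k A : Type*} [Field k] [Ring A] [Algebra k A] (n : ℕ)
    [NeZero n] (hn : (n : k) ≠ 0) (ξ : k) (hξ : IsPrimitiveRoot ξ n) (z : Fin n → A)
    (hcomm : ∀ i j, Commute (z i) (z j))
    (h : ∀ m : ZMod n, IsNilpotent (∑ i : Fin n, (ξ ^ ((i.val + 1) * m.val)) • z i))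
    (l : Fin n) : IsNilpotent (z l) := by
  classical
  have hξ0 : ξ ≠ 0 := hξ.ne_zero (NeZero.ne n)
  have hinv : (n : k) • z l = ∑ m : ZMod n, ((ξ ^ (l.val + 1))⁻¹ ^ m.val) •
      ∑ i : Fin n, (ξ ^ ((i.val + 1) * m.val)) • z i := by
    simp_rw [Finset.smul_sum, smul_smul]
    rw [Finset.sum_comm]
    simp_rw [← Finset.sum_smul, pow_mul, ← mul_pow]
    rw [Finset.sum_eq_single l]
    · simp [hξ0]
    · intro i _ hi
      rw [ZMod.sum_pow_val_eq_ite, if_neg, zero_smul]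
      · rw [inv_mul_eq_one₀ (pow_ne_zero _ hξ0), pow_succ, pow_succ]
        intro he
        exact hi (Fin.ext (hξ.pow_inj l.2 i.2 (mul_right_cancel₀ hξ0 he)).symm)
      · rw [mul_pow, inv_pow, ← pow_mul, ← pow_mul, mul_comm _ n, mul_comm _ n, pow_mul, pow_mul,
          hξ.pow_eq_one]
        simp
    · simp
  have hnil : IsNilpotent ((n : k) • z l) := by
    rw [hinv]
    refine Commute.isNilpotent_sum (fun m _ => (h m).smul _) fun m m' _ _ => ?_
    refine Commute.smul_left (Commute.smul_right ?_ _) _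
    refine Commute.sum_left _ _ _ fun i _ => Commute.sum_right _ _ _ fun j _ => ?_
    exact Commute.smul_left (Commute.smul_right (hcomm i j) _) _
  simpa [smul_smul, hn] using hnil.smul (n : k)⁻¹

theorem isNilpotent_of_anticommuting_of_fourier_relations {k A : Type*} [Field k] [Ring A]
    [Algebra k A] (n : ℕ) [NeZero n] (h2 : (2 : k) ≠ 0) (hn : (n : k) ≠ 0) (ξ : k)
    (hξ : IsPrimitiveRoot ξ n) (x : Fin n → A)
    (hanti : ∀ i j, i ≠ j → x i * x j = -(x j * x i)) (y : ZMod n → A)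
    (hy : ∀ m, y m = ∑ i : Fin n, (ξ ^ ((i.val + 1) * m.val)) • x i)
    (hsq : ∀ m, y m ^ 2 = 0) (hmul : ∀ s, (y s * y (s - 1)) ^ n = 0) (l : Fin n) :
    IsNilpotent (x l) := by
  have hadd : ∀ s t : ZMod n, y s * y t + y t * y s =
      (2 : k) • ∑ i : Fin n, (ξ ^ ((i.val + 1) * (s + t).val)) • x i ^ 2 := by
    intro s t
    rw [hy, hy, sum_smul_mul_add_sum_smul_mul x hanti]
    congr 1
    refine Finset.sum_congr rfl fun i _ => ?_
    congr 1
    rw [← pow_add, ← mul_add, mul_comm, pow_mul, mul_comm, pow_mul, ZMod.val_add]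
    congr 1
    exact pow_eq_pow_mod _ hξ.pow_eq_one
  have hsum : ∀ s t : ZMod n, IsNilpotent (y s * y t + y t * y s) →
      IsNilpotent (∑ i : Fin n, (ξ ^ ((i.val + 1) * (s + t).val)) • x i ^ 2) := by
    intro s t hst
    rw [hadd] at hst
    simpa [smul_smul, h2] using hst.smul (2 : k)⁻¹
  have hcomm : ∀ i j, Commute (x i ^ 2) (x j ^ 2) := by
    intro i j
    by_cases hij : i = j
    · rw [hij]
    · have hone : Commute (x i) (x j ^ 2) := by
        rw [commute_iff_eq, sq, ← mul_assoc, hanti i j hij, neg_mul, mul_assoc, hanti i j hij,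
          mul_neg, neg_neg, mul_assoc]
      exact hone.pow_left 2
  refine (IsNilpotent.pow_iff_pos two_ne_zero).1
    (isNilpotent_of_fourier_sums n hn ξ hξ (fun i => x i ^ 2) hcomm (fun m => ?_) l)
  rcases Nat.even_or_odd' m.val with ⟨c, hc | hc⟩
  · have hm : m = (c : ZMod n) + c := by
      rw [← ZMod.natCast_zmod_val m, hc]; push_cast; ring
    rw [hm]
    exact hsum _ _ (by simp [← sq, hsq])
  · have hm : m = ((c : ZMod n) + 1) + ((c : ZMod n) + 1 - 1) := by
      rw [← ZMod.natCast_zmod_val m, hc]; push_cast; ring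
    rw [hm]
    exact hsum _ _ (isNilpotent_mul_add_mul_of_sq_eq_zero (hsq _) (hsq _) ⟨n, hmul _⟩)

theorem adjoin_range_skewX (k : Type) [Field k] (n : ℕ) :
    Algebra.adjoin k (Set.range (skewX k n)) = ⊤ := by
  have h : Set.range (skewX k n) =
      RingQuot.mkAlgHom k (SkewRel k n) '' Set.range (FreeAlgebra.ι k) := by
    rw [← Set.range_comp]; rfl
  rw [h, ← AlgHom.map_adjoin, FreeAlgebra.adjoin_range_ι, Algebra.map_top,
    AlgHom.range_eq_top]
  exact RingQuot.mkAlgHom_surjective k _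

theorem skewX_mul_skewX (k : Type) [Field k] (n : ℕ) {i j : Fin n} (h : i ≠ j) :
    skewX k n i * skewX k n j = -(skewX k n j * skewX k n i) := by
  simpa [skewX] using RingQuot.mkAlgHom_rel k (SkewRel.rel (k := k) i j h)

/-!
STATEMENT 9: Suppose `n = 2^d` for some `d ≥ 1`.  Then the quotient of `R` by
the two-sided ideal generated by `{y_i² : i ∈ ℤ/nℤ}` together with
`{(y_s y_{s-1})^n : s ∈ ℤ/nℤ}` is a finite-dimensional `k`-vector space.
(Lemma 5.3(7).)  The two-sided ideal generated by a set `S` coincides, as a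
`k`-subspace, with the `k`-span of `{a * g * b : a, b ∈ R, g ∈ S}`.
-/

theorem stmt9 {k : Type} [Field k] (n : ℕ) (hn : 2 ≤ n)
    (hchar : ¬ ((ringChar k) ∣ 2 * n))
    (ξ : k) (hξ : IsPrimitiveRoot ξ n)
    (d : ℕ) (hd : 1 ≤ d) (hnd : n = 2 ^ d) :
    FiniteDimensional k
      (SkewPoly k n ⧸
        Submodule.span k {r : SkewPoly k n | ∃ a b g : SkewPoly k n,
          ((∃ i : ZMod n, g = (skewY k n ξ i) ^ 2) ∨
            (∃ s : ZMod n, g = (skewY k n ξ s * skewY k n ξ (s - 1)) ^ n)) ∧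
          r = a * g * b}) := by
  have : NeZero n := ⟨by omega⟩
  have h2n : ((2 * n : ℕ) : k) ≠ 0 := fun h => hchar ((ringChar.spec k _).1 h)
  rw [Nat.cast_mul] at h2n
  let S : Set (SkewPoly k n) := {g | (∃ i : ZMod n, g = (skewY k n ξ i) ^ 2) ∨
    (∃ s : ZMod n, g = (skewY k n ξ s * skewY k n ξ (s - 1)) ^ n)}
  let f : SkewPoly k n →ₐ[k] (TwoSidedIdeal.span S).ringCon.Quotient :=
    (TwoSidedIdeal.span S).ringCon.mkₐ (α := k)
  have hfS : ∀ g ∈ S, f g = 0 := fun g hg =>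
    (RingCon.eq _).2 ((TwoSidedIdeal.mem_iff _ _).1 (TwoSidedIdeal.subset_span hg))
  have hgen : Algebra.adjoin k (Set.range fun i => f (skewX k n i)) = ⊤ := by
    rw [show (Set.range fun i => f (skewX k n i)) = f '' Set.range (skewX k n) from
      Set.range_comp f (skewX k n), ← AlgHom.map_adjoin, adjoin_range_skewX, Algebra.map_top,
      AlgHom.range_eq_top]
    exact RingCon.mkₐ_surjective _
  have hanti : ∀ i j, i ≠ j →
      f (skewX k n i) * f (skewX k n j) = -(f (skewX k n j) * f (skewX k n i)) := by
    intro i j hij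
    rw [← map_mul, skewX_mul_skewX k n hij, map_neg, map_mul]
  have : Module.Finite k (TwoSidedIdeal.span S).ringCon.Quotient := by
    refine Module.finite_of_anticommuting_nilpotent_generators (fun i => f (skewX k n i)) hgen
      hanti (isNilpotent_of_anticommuting_of_fourier_relations n ?_ ?_ ξ hξ _ hanti
        (fun m => f (skewY k n ξ m)) ?_ ?_ ?_)
    · exact_mod_cast left_ne_zero_of_mul h2n
    · exact right_ne_zero_of_mul h2n
    · intro m
      simp [skewY]
    · intro m
      rw [← map_pow]
      exact hfS _ (Or.inl ⟨m, rfl⟩)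
    · intro s
      rw [← map_mul, ← map_pow]
      exact hfS _ (Or.inr ⟨s, rfl⟩)
  exact Module.finite_quotient_span_of_finite_ringCon_quotient S
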